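/- arXiv:1903.00851 — 4 statements merged into one kernel-verified Lean document; each statement's English description precedes it below -/
import Mathlib

section
/- Fix σ > 0, μ₀, x̄, μ₁ ∈ ℝ and a natural number n ≥ 1. For λ₀ > 0 define S(λ₀) = 1 − Φ( (1/σ² + 1/(nλ₀²σ²))^{1/2} · √n|x̄ − μ₁| + √n x̄/(nλ₀² + 1) − √n μ₀/(nλ₀² + 1) ) + Φ( (1/σ² + 1/(nλ₀²σ²))^{1/2} · (−√n|x̄ − μ₁|) + √n x̄/(nλ₀² + 1) − √n μ₀/(nλ₀² + 1) ). Then S(λ₀) → 2(1 − Φ(√n|x̄ − μ₁|/σ)) as λ₀ → ∞. -/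
open MeasureTheory ProbabilityTheory Filter Topology

/-- The standard normal cumulative distribution function `Φ`. -/
noncomputable def stdNormalCDF (z : ℝ) : ℝ := (gaussianReal 0 1 (Set.Iic z)).toReal

/-- The strength `S(λ₀)` of the evidence in the one-sample z-test with prior `N(μ₀, λ₀²σ²)`,
in closed form.  (`lam0` plays the role of `λ₀`.) -/
noncomputable def strengthZ (σ μ₀ xbar μ₁ : ℝ) (n : ℕ) (lam0 : ℝ) : ℝ :=
  1 - stdNormalCDF ((1 / σ ^ 2 + 1 / ((n : ℝ) * lam0 ^ 2 * σ ^ 2)) ^ ((1 : ℝ) / 2) *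
        (Real.sqrt n * |xbar - μ₁|) +
      Real.sqrt n * xbar / ((n : ℝ) * lam0 ^ 2 + 1) -
      Real.sqrt n * μ₀ / ((n : ℝ) * lam0 ^ 2 + 1)) +
    stdNormalCDF ((1 / σ ^ 2 + 1 / ((n : ℝ) * lam0 ^ 2 * σ ^ 2)) ^ ((1 : ℝ) / 2) *
        (-(Real.sqrt n * |xbar - μ₁|)) +
      Real.sqrt n * xbar / ((n : ℝ) * lam0 ^ 2 + 1) -
      Real.sqrt n * μ₀ / ((n : ℝ) * lam0 ^ 2 + 1))

/-- The standard normal cumulative distribution function is continuous. -/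
lemma continuous_stdNormalCDF : Continuous stdNormalCDF := by
  have hna : NullSingletonClass (gaussianReal 0 1) := nullSingletonClass_gaussianReal one_ne_zero
  have h : stdNormalCDF = cdf (gaussianReal 0 1) := by
    ext x
    rw [cdf_eq_real, stdNormalCDF, measureReal_def]
  rw [h, continuous_iff_continuousAt]
  intro x
  set F := cdf (gaussianReal 0 1)
  rw [F.mono.continuousAt_iff_leftLim_eq_rightLim, F.rightLim_eq]
  have hx : F.measure {x} = 0 := by
    rw [measure_cdf]
    exact measure_singleton x
  rw [F.measure_singleton, ENNReal.ofReal_eq_zero] at hx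
  exact le_antisymm (F.mono.leftLim_le le_rfl) (by linarith)

/-- Symmetry of the standard normal distribution: `Φ(-z) = 1 - Φ(z)`. -/
lemma stdNormalCDF_neg (z : ℝ) : stdNormalCDF (-z) = 1 - stdNormalCDF z := by
  have hna : NullSingletonClass (gaussianReal 0 1) := nullSingletonClass_gaussianReal one_ne_zero
  have hmap : gaussianReal 0 1 (Set.Iic (-z)) = gaussianReal 0 1 (Set.Ici z) := by
    conv_lhs => rw [← neg_zero, ← gaussianReal_map_neg]
    rw [Measure.map_apply measurable_neg measurableSet_Iic]
    congr 1
    ext x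
    simp
  rw [stdNormalCDF, stdNormalCDF, hmap, ← measure_congr Ioi_ae_eq_Ici, ← Set.compl_Iic,
    ← measureReal_def, ← measureReal_def, probReal_compl_eq_one_sub measurableSet_Iic]

/-- As `λ₀ → ∞`, the strength `S(λ₀)` converges to `2(1 − Φ(√n |x̄ − μ₁| / σ))`. -/
theorem strength_tendsto_of_diffuse_prior (σ μ₀ xbar μ₁ : ℝ) (hσ : 0 < σ) (n : ℕ) (hn : 1 ≤ n) :
    Tendsto (fun lam0 : ℝ => strengthZ σ μ₀ xbar μ₁ n lam0) atTop
      (𝓝 (2 * (1 - stdNormalCDF (Real.sqrt n * |xbar - μ₁| / σ)))) := by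
  have hn' : (0 : ℝ) < n := by exact_mod_cast hn
  have hlam : Tendsto (fun lam0 : ℝ => (n : ℝ) * lam0 ^ 2) atTop atTop :=
    (tendsto_pow_atTop two_ne_zero).const_mul_atTop hn'
  have hshift (c : ℝ) : Tendsto (fun lam0 : ℝ => c / ((n : ℝ) * lam0 ^ 2 + 1)) atTop (𝓝 0) :=
    (tendsto_atTop_add_const_right _ _ hlam).const_div_atTop c
  have hscale : Tendsto (fun lam0 : ℝ =>
      (1 / σ ^ 2 + 1 / ((n : ℝ) * lam0 ^ 2 * σ ^ 2)) ^ ((1 : ℝ) / 2)) atTop (𝓝 (1 / σ)) := by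
    have hlim : ((1 / σ ^ 2 + 0) ^ ((1 : ℝ) / 2) : ℝ) = 1 / σ := by
      rw [add_zero, ← Real.sqrt_eq_rpow, ← one_div_pow, Real.sqrt_sq (by positivity)]
    rw [← hlim]
    refine Tendsto.rpow_const (tendsto_const_nhds.add ?_) (Or.inr (by norm_num))
    exact (hlam.atTop_mul_const (by positivity)).const_div_atTop 1
  have harg (c : ℝ) := ((hscale.mul_const c).add (hshift (Real.sqrt n * xbar))).sub
    (hshift (Real.sqrt n * μ₀))
  have hΦ (c : ℝ) := (continuous_stdNormalCDF.tendsto _).comp (harg c)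
  have h := ((hΦ (Real.sqrt n * |xbar - μ₁|)).const_sub 1).add
    (hΦ (-(Real.sqrt n * |xbar - μ₁|)))
  convert h using 2
  · rfl
  · rw [add_zero, sub_zero, add_zero, sub_zero, mul_neg, stdNormalCDF_neg, one_div_mul_eq_div]
    ring
end

section
/- Let m ∈ ℝ, s > 0 and t₀ ∈ ℝ, and let T be a random variable with law N(m, s²). Then P( φ(m, s²)(T) ≤ φ(m, s²)(t₀) ) = 2(1 − Φ(|t₀ − m|/s)). (In particular, taking m = μ₀ and s² = λ₀²σ² + σ²/n, the prior-data conflict check M_T(m_T(t) ≤ m_T(x̄)) for the z-test equals 2(1 − Φ(|x̄ − μ₀|/(λ₀²σ² + σ²/n)^{1/2})).) -/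
open MeasureTheory ProbabilityTheory Real

/-- The density of the normal distribution `N(m, v)` (mean `m`, variance `v`). -/
noncomputable def normalPDF (m v t : ℝ) : ℝ :=
  (Real.sqrt (2 * π * v))⁻¹ * Real.exp (-(t - m) ^ 2 / (2 * v))

lemma normalPDF_le_normalPDF_iff (m t t₀ : ℝ) {v : ℝ} (hv : 0 < v) :
    normalPDF m v t ≤ normalPDF m v t₀ ↔ |t₀ - m| ≤ |t - m| := by
  have hc : 0 < (Real.sqrt (2 * π * v))⁻¹ := by positivity
  unfold normalPDF
  rw [mul_le_mul_iff_right₀ hc, Real.exp_le_exp, div_le_div_iff_of_pos_right (by positivity),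
    neg_le_neg_iff, sq_le_sq]

lemma gaussianReal_eq_map_standard (m : ℝ) {s : ℝ} :
    gaussianReal m (s ^ 2).toNNReal = (gaussianReal 0 1).map (fun z ↦ m + s * z) := by
  have h : (fun z : ℝ ↦ m + s * z) = (fun x ↦ m + x) ∘ (fun z ↦ s * z) := rfl
  rw [h, ← Measure.map_map (by fun_prop) (by fun_prop), gaussianReal_map_const_mul,
    gaussianReal_map_const_add]
  congr 1
  · simp
  · ext
    simp [sq_nonneg]

/-- The two-sided tail probability of the standard normal distribution. -/
lemma gaussianReal_real_le_abs {a : ℝ} (ha : 0 ≤ a) :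
    (gaussianReal 0 1).real {z : ℝ | a ≤ |z|} = 2 * (1 - stdNormalCDF a) := by
  have : NullSingletonClass (gaussianReal 0 1) := nullSingletonClass_gaussianReal one_ne_zero
  have hset : {z : ℝ | a ≤ |z|} = Set.Iic (-a) ∪ Set.Ici a := by
    ext z
    simp only [Set.mem_ofPred_eq, Set.mem_union, Set.mem_Iic, Set.mem_Ici, le_abs, le_neg]
    exact or_comm
  have hupper : (gaussianReal 0 1).real (Set.Ioi a) = 1 - stdNormalCDF a := by
    rw [← Set.compl_Iic, probReal_compl_eq_one_sub measurableSet_Iic]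
    rfl
  have hae : Set.Ici a =ᵐ[gaussianReal 0 1] Set.Ioi a := Ioi_ae_eq_Ici.symm
  have hlower : (gaussianReal 0 1).real (Set.Iic (-a)) = 1 - stdNormalCDF a := by
    have hneg : (gaussianReal 0 1).map (fun x ↦ -x) = gaussianReal 0 1 := by
      rw [gaussianReal_map_neg, neg_zero]
    rw [← hneg, map_measureReal_apply measurable_neg measurableSet_Iic, Set.neg_preimage,
      Set.neg_Iic, neg_neg, measureReal_congr hae, hupper]
  have hdisj : Disjoint (Set.Iic (-a)) (Set.Ioi a) :=
    Set.Iic_disjoint_Ioi (by linarith)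
  rw [hset, measureReal_congr (Filter.EventuallyEq.rfl.union hae),
    measureReal_union hdisj measurableSet_Ioi, hlower, hupper]
  ring

/-- If `T ~ N(m, s²)`, then `P(φ(m,s²)(T) ≤ φ(m,s²)(t₀)) = 2(1 − Φ(|t₀ − m|/s))`: the
prior-data conflict check for the z-test locates the observed value in its prior predictive
distribution. -/
theorem prior_data_conflict_closed_form (m s t₀ : ℝ) (hs : 0 < s) :
    (gaussianReal m (s ^ 2).toNNReal
        {t : ℝ | normalPDF m (s ^ 2) t ≤ normalPDF m (s ^ 2) t₀}).toReal =
      2 * (1 - stdNormalCDF (|t₀ - m| / s)) := by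
  have hset : {t : ℝ | normalPDF m (s ^ 2) t ≤ normalPDF m (s ^ 2) t₀} =
      {t : ℝ | |t₀ - m| ≤ |t - m|} := by
    ext t
    exact normalPDF_le_normalPDF_iff m t t₀ (by positivity)
  have hmeas : MeasurableSet {t : ℝ | |t₀ - m| ≤ |t - m|} :=
    measurableSet_le (by fun_prop) (by fun_prop)
  have hpre : (fun z : ℝ ↦ m + s * z) ⁻¹' {t : ℝ | |t₀ - m| ≤ |t - m|} =
      {z : ℝ | |t₀ - m| / s ≤ |z|} := by
    ext z
    simp [abs_mul, abs_of_pos hs, div_le_iff₀' hs]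
  rw [hset, gaussianReal_eq_map_standard, Measure.map_apply (by fun_prop) hmeas, hpre]
  exact gaussianReal_real_le_abs (by positivity)
end

section
/- Let α₀ > 0, β₀ > 0, λ₀ > 0, μ₀, x̄ ∈ ℝ, s² ≥ 0, and let n ≥ 1 be a natural number. Set β_x = β₀ + (n − 1)s²/2 + n(x̄ − μ₀)²/(2(nλ₀² + 1)). Then ∫₀^∞ ∫_ℝ (β₀^{α₀}/Γ(α₀)) τ^{α₀ − 1} e^{−β₀ τ} · (τ/(2πλ₀²))^{1/2} exp(−τ(μ − μ₀)²/(2λ₀²)) · (2π)^{−n/2} τ^{n/2} exp(−(τ/2)[(n − 1)s² + n(x̄ − μ)²]) dμ dτ = (Γ(n/2 + α₀)/Γ(α₀)) · (n + 1/λ₀²)^{−1/2} · (2π)^{−n/2} (β₀^{α₀}/λ₀) · β_x^{−(n/2 + α₀)}. (Closed form of the joint prior predictive density m_T(x̄, s²) of the minimal sufficient statistic in the one-sample t-test with the normal-gamma prior.) -/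
open Real

/-- The sum of two weighted squares, after completing the square in `t`. -/
lemma weighted_sq_add_weighted_sq {a b : ℝ} (hab : a + b ≠ 0) (u v t : ℝ) :
    a * (t - u) ^ 2 + b * (v - t) ^ 2 =
      (a + b) * (t - (a * u + b * v) / (a + b)) ^ 2 + a * b / (a + b) * (v - u) ^ 2 := by
  field_simp
  ring

/-- The integral of a product of two Gaussian kernels with common scale `τ`. -/
lemma integral_exp_neg_weighted_sq_add_weighted_sq {a b : ℝ} (hab : a + b ≠ 0) (τ u v : ℝ) :
    ∫ t : ℝ, Real.exp (-(τ / 2) * (a * (t - u) ^ 2 + b * (v - t) ^ 2)) =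
      Real.exp (-(τ / 2) * (a * b / (a + b) * (v - u) ^ 2)) *
        Real.sqrt (π / (τ / 2 * (a + b))) := by
  rw [← integral_gaussian, ← MeasureTheory.integral_sub_right_eq_self
    (fun t : ℝ => Real.exp (-(τ / 2 * (a + b)) * t ^ 2)) ((a * u + b * v) / (a + b)),
    ← MeasureTheory.integral_const_mul]
  congr 1
  ext t
  rw [weighted_sq_add_weighted_sq hab, ← Real.exp_add]
  ring_nf

/-- The normalizing constants of the prior and of the posterior of the mean cancel up to a
factor independent of `τ`. -/
lemma sqrt_div_mul_sqrt_pi_div {τ l k : ℝ} (hτ : 0 < τ) (hl : 0 < l) (hk : 0 < k) :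
    Real.sqrt (τ / (2 * π * l ^ 2)) * Real.sqrt (π / (τ / 2 * k)) =
      k ^ (-(1 : ℝ) / 2) / l := by
  have h : τ / (2 * π * l ^ 2) * (π / (τ / 2 * k)) = k⁻¹ / l ^ 2 := by
    have := Real.pi_pos
    field_simp
  rw [← Real.sqrt_mul (by positivity), h, Real.sqrt_div (by positivity),
    Real.sqrt_sq hl.le, Real.sqrt_eq_rpow, neg_div, Real.rpow_neg hk.le,
    Real.inv_rpow hk.le]

/-- Closed form of the joint prior predictive density `m_T(x̄, s²)` of the minimal sufficient
statistic in the one-sample t-test with the normal-gamma prior: integrating the normal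
likelihood against the prior `τ = 1/σ² ~ gamma(α₀, β₀)`, `μ | τ ~ N(μ₀, λ₀²/τ)` gives
`(Γ(n/2 + α₀)/Γ(α₀)) (n + 1/λ₀²)^{−1/2} (2π)^{−n/2} (β₀^{α₀}/λ₀) β_x^{−(n/2 + α₀)}` where
`β_x = β₀ + (n − 1)s²/2 + n(x̄ − μ₀)²/(2(nλ₀² + 1))`.  (`lam0` plays the role of `λ₀` and
`s2` the role of `s²`.) -/
theorem joint_prior_predictive_integral (α₀ β₀ lam0 μ₀ xbar s2 : ℝ)
    (hα : 0 < α₀) (hβ : 0 < β₀) (hlam : 0 < lam0) (hs2 : 0 ≤ s2) (n : ℕ) (hn : 1 ≤ n) :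
    ∫ τ in Set.Ioi (0 : ℝ), ∫ μ : ℝ,
        (β₀ ^ α₀ / Real.Gamma α₀) * τ ^ (α₀ - 1) * Real.exp (-β₀ * τ) *
          (Real.sqrt (τ / (2 * π * lam0 ^ 2)) *
            Real.exp (-τ * (μ - μ₀) ^ 2 / (2 * lam0 ^ 2))) *
          ((2 * π) ^ (-(n : ℝ) / 2) * τ ^ ((n : ℝ) / 2) *
            Real.exp (-(τ / 2) * (((n : ℝ) - 1) * s2 + (n : ℝ) * (xbar - μ) ^ 2))) =
      (Real.Gamma ((n : ℝ) / 2 + α₀) / Real.Gamma α₀) *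
        ((n : ℝ) + 1 / lam0 ^ 2) ^ (-(1 : ℝ) / 2) * (2 * π) ^ (-(n : ℝ) / 2) *
        (β₀ ^ α₀ / lam0) *
        (β₀ + ((n : ℝ) - 1) * s2 / 2 +
            (n : ℝ) * (xbar - μ₀) ^ 2 / (2 * ((n : ℝ) * lam0 ^ 2 + 1))) ^
          (-((n : ℝ) / 2 + α₀)) := by
  have hn' : (1 : ℝ) ≤ n := by exact_mod_cast hn
  have hk : 0 < (n : ℝ) + 1 / lam0 ^ 2 := by positivity
  have hk' : 1 / lam0 ^ 2 + (n : ℝ) ≠ 0 := by positivity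
  set B := β₀ + ((n : ℝ) - 1) * s2 / 2 +
    (n : ℝ) * (xbar - μ₀) ^ 2 / (2 * ((n : ℝ) * lam0 ^ 2 + 1)) with hB
  have hB_pos : 0 < B := by
    have : 0 ≤ ((n : ℝ) - 1) * s2 := mul_nonneg (by linarith) hs2
    positivity
  have inner : ∀ τ ∈ Set.Ioi (0 : ℝ), (∫ μ : ℝ,
        (β₀ ^ α₀ / Real.Gamma α₀) * τ ^ (α₀ - 1) * Real.exp (-β₀ * τ) *
          (Real.sqrt (τ / (2 * π * lam0 ^ 2)) *
            Real.exp (-τ * (μ - μ₀) ^ 2 / (2 * lam0 ^ 2))) *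
          ((2 * π) ^ (-(n : ℝ) / 2) * τ ^ ((n : ℝ) / 2) *
            Real.exp (-(τ / 2) * (((n : ℝ) - 1) * s2 + (n : ℝ) * (xbar - μ) ^ 2)))) =
      (β₀ ^ α₀ / Real.Gamma α₀ * (2 * π) ^ (-(n : ℝ) / 2) *
        (((n : ℝ) + 1 / lam0 ^ 2) ^ (-(1 : ℝ) / 2) / lam0)) *
        (τ ^ ((n : ℝ) / 2 + α₀ - 1) * Real.exp (-(B * τ))) := by
    intro τ hτ
    have hτ : 0 < τ := hτ
    have hexp : Real.exp (-(B * τ)) = Real.exp (-β₀ * τ - τ / 2 * (((n : ℝ) - 1) * s2)) *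
        Real.exp (-(τ / 2) *
          (1 / lam0 ^ 2 * n / (1 / lam0 ^ 2 + n) * (xbar - μ₀) ^ 2)) := by
      rw [← Real.exp_add, hB]
      congr 1
      field_simp
      ring
    have hpow : τ ^ ((n : ℝ) / 2 + α₀ - 1) = τ ^ (α₀ - 1) * τ ^ ((n : ℝ) / 2) := by
      rw [← Real.rpow_add hτ]
      ring_nf
    rw [hexp, hpow, ← sqrt_div_mul_sqrt_pi_div hτ hlam hk, add_comm (n : ℝ) (1 / lam0 ^ 2)]
    trans (β₀ ^ α₀ / Real.Gamma α₀ * (2 * π) ^ (-(n : ℝ) / 2) *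
        Real.sqrt (τ / (2 * π * lam0 ^ 2)) * (τ ^ (α₀ - 1) * τ ^ ((n : ℝ) / 2)) *
        Real.exp (-β₀ * τ - τ / 2 * (((n : ℝ) - 1) * s2))) *
        ∫ μ : ℝ, Real.exp (-(τ / 2) * (1 / lam0 ^ 2 * (μ - μ₀) ^ 2 + n * (xbar - μ) ^ 2))
    · rw [← MeasureTheory.integral_const_mul]
      congr 1
      ext μ
      have hsplit : Real.exp (-β₀ * τ) * Real.exp (-τ * (μ - μ₀) ^ 2 / (2 * lam0 ^ 2)) *
            Real.exp (-(τ / 2) * (((n : ℝ) - 1) * s2 + (n : ℝ) * (xbar - μ) ^ 2)) =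
          Real.exp (-β₀ * τ - τ / 2 * (((n : ℝ) - 1) * s2)) *
            Real.exp (-(τ / 2) * (1 / lam0 ^ 2 * (μ - μ₀) ^ 2 + n * (xbar - μ) ^ 2)) := by
        simp only [← Real.exp_add]
        congr 1
        field_simp
        ring
      linear_combination (β₀ ^ α₀ / Real.Gamma α₀ * (2 * π) ^ (-(n : ℝ) / 2) *
        Real.sqrt (τ / (2 * π * lam0 ^ 2)) * (τ ^ (α₀ - 1) * τ ^ ((n : ℝ) / 2))) * hsplit
    · rw [integral_exp_neg_weighted_sq_add_weighted_sq hk']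
      ring
  rw [MeasureTheory.setIntegral_congr_fun measurableSet_Ioi inner,
    MeasureTheory.integral_const_mul,
    Real.integral_rpow_mul_exp_neg_mul_Ioi (by positivity) hB_pos, one_div B,
    Real.inv_rpow hB_pos.le, ← Real.rpow_neg hB_pos.le]
  ring
end

section
/- Let α₀ > 0, β₀ > 0, λ₀ > 0, x̄, μ₁ ∈ ℝ, s² ≥ 0, and let n ≥ 1 be a natural number. Define RB(μ) = (n + 1/λ₀²)^{1/2} · [ (β₀ + (n−1)s²/2 + (n/2)(x̄ − μ)²) / (β₀ + (n−1)s²/2 + (n/2)(x̄ − μ)²/(nλ₀² + 1)) ]^{−(n/2 + α₀)}. Then for every μ ∈ ℝ: RB(μ) ≤ RB(μ₁) if and only if (x̄ − μ)² ≥ (x̄ − μ₁)². (The strength Π(RB(μ|x) ≤ RB(μ₁|x)|x) in the one-sample t-test equals the posterior probability that |μ − x̄| ≥ |x̄ − μ₁|.) -/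
open Real

/-- The relative belief ratio of `μ` in the one-sample t-test with unknown variance,
normal-gamma prior with hyperparameters `(μ₀, λ₀, α₀, β₀)`, and minimal sufficient statistic
`(x̄, s²)` from `n` observations.  (`lam0` plays the role of `λ₀` and `s2` of `s²`.) -/
noncomputable def RBt (α₀ β₀ lam0 xbar s2 : ℝ) (n : ℕ) (μ : ℝ) : ℝ :=
  ((n : ℝ) + 1 / lam0 ^ 2) ^ ((1 : ℝ) / 2) *
    ((β₀ + ((n : ℝ) - 1) * s2 / 2 + (n : ℝ) / 2 * (xbar - μ) ^ 2) /
        (β₀ + ((n : ℝ) - 1) * s2 / 2 +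
          (n : ℝ) / 2 * (xbar - μ) ^ 2 / ((n : ℝ) * lam0 ^ 2 + 1))) ^
      (-((n : ℝ) / 2 + α₀))

/-- For `A, k > 0` and `c > 1`, the map `t ↦ (A + k t) / (A + k t / c)` is strictly increasing on
the nonnegative reals. -/
lemma add_mul_div_add_mul_div_le_iff {A k c t u : ℝ} (hA : 0 < A) (hk : 0 < k) (hc : 1 < c)
    (ht : 0 ≤ t) (hu : 0 ≤ u) :
    (A + k * t) / (A + k * t / c) ≤ (A + k * u) / (A + k * u / c) ↔ t ≤ u := by
  have hc0 : 0 < c := one_pos.trans hc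
  have hcoef : 0 < A * k * (1 - 1 / c) :=
    mul_pos (mul_pos hA hk) (sub_pos.2 ((div_lt_one hc0).2 hc))
  have hcross : (A + k * u) * (A + k * t / c) - (A + k * t) * (A + k * u / c) =
      A * k * (1 - 1 / c) * (u - t) := by ring
  rw [div_le_div_iff₀ (by positivity) (by positivity), ← sub_nonneg, hcross,
    mul_nonneg_iff_of_pos_left hcoef, sub_nonneg]

/-- For the t-test relative belief ratio, `RB(μ) ≤ RB(μ₁)` if and only if
`(x̄ − μ)² ≥ (x̄ − μ₁)²`: the strength `Π(RB(μ|x) ≤ RB(μ₁|x)|x)` equals the posterior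
probability that `|μ − x̄| ≥ |x̄ − μ₁|`. -/
theorem RBt_le_iff (α₀ β₀ lam0 xbar μ₁ s2 : ℝ) (hα : 0 < α₀) (hβ : 0 < β₀) (hlam : 0 < lam0)
    (hs2 : 0 ≤ s2) (n : ℕ) (hn : 1 ≤ n) :
    ∀ μ : ℝ, RBt α₀ β₀ lam0 xbar s2 n μ ≤ RBt α₀ β₀ lam0 xbar s2 n μ₁ ↔
      (xbar - μ) ^ 2 ≥ (xbar - μ₁) ^ 2 := by
  intro μ
  have hn1 : (1 : ℝ) ≤ n := by exact_mod_cast hn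
  have hk : (0 : ℝ) < (n : ℝ) / 2 := by positivity
  have hA : 0 < β₀ + ((n : ℝ) - 1) * s2 / 2 := by
    have := mul_nonneg (sub_nonneg.2 hn1) hs2
    positivity
  have hc : 1 < (n : ℝ) * lam0 ^ 2 + 1 := lt_add_of_pos_left 1 (by positivity)
  unfold RBt
  rw [mul_le_mul_iff_right₀ (by positivity),
    rpow_le_rpow_iff_of_neg (by positivity) (by positivity) (by linarith),
    add_mul_div_add_mul_div_le_iff hA hk hc (sq_nonneg _) (sq_nonneg _)]
end
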